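/- Let n ≥ 1, γ ∈ ℝ, and n < p < +∞. There exists a constant C > 0 such that: if ω : ℝⁿ₊ × ℝⁿ₊ → [0, +∞) is continuous and satisfies, for every smooth function u : ℝⁿ → ℝ with finite weighted energy E_γ(u) < +∞ and for all x, y ∈ ℝⁿ₊, the estimate |u(x) − u(y)| ≤ ω(x, y) · E_γ(u)^{1/p}, then for all x, y ∈ ℝⁿ₊ one has ω(x, y) ≥ C · Θ_γ(x, y). -/

import Mathlib

open MeasureTheory Real Set
open scoped ENNReal

noncomputable section

/-- The last coordinate `xₙ` of a point of `ℝⁿ`. -/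
def lastCoord (n : ℕ) (x : EuclideanSpace ℝ (Fin n)) : ℝ :=
  if h : 0 < n then x ⟨n - 1, Nat.sub_lt h one_pos⟩ else 0

/-- The open upper half-space `ℝⁿ₊`. -/
def upperHalf (n : ℕ) : Set (EuclideanSpace ℝ (Fin n)) :=
  {z | 0 < lastCoord n z}

/-- The weighted energy `E_γ(u) = ∫_{ℝⁿ₊} ‖Du(z)‖^p zₙ^γ dz`, as a value in `[0, +∞]`. -/
def energy (n : ℕ) (γ p : ℝ) (u : EuclideanSpace ℝ (Fin n) → ℝ) : ℝ≥0∞ :=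
  ∫⁻ z in upperHalf n, ENNReal.ofReal (‖fderiv ℝ u z‖ ^ p * lastCoord n z ^ γ)

/-- The function `Θ_γ` from the weighted Morrey–Sobolev inequality. -/
def Theta (n : ℕ) (γ p : ℝ) (x y : EuclideanSpace ℝ (Fin n)) : ℝ :=
  if p - n < γ then
    ‖x - y‖ ^ (1 - (n : ℝ) / p) /
      (min (lastCoord n x) (lastCoord n y) ^ (((n : ℝ) + γ) / p - 1) *
        max (max (lastCoord n x) (lastCoord n y)) ‖x - y‖ ^ (1 - (n : ℝ) / p))
  else if γ = p - n then
    (Real.log (1 + (‖x - y‖ / min (lastCoord n x) (lastCoord n y)) ^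
        ((p - n) / (p - 1)))) ^ (1 - 1 / p)
  else if -1 < γ then
    ‖x - y‖ ^ (1 - (n : ℝ) / p) /
      max (max (lastCoord n x) (lastCoord n y)) ‖x - y‖ ^ (γ / p)
  else
    max (lastCoord n x) (lastCoord n y) ^ (1 - ((n : ℝ) + γ) / p) *
        ‖x - y‖ ^ (1 - (n : ℝ) / p) /
      max (max (lastCoord n x) (lastCoord n y)) ‖x - y‖ ^ (1 - (n : ℝ) / p)

/-- A fixed smooth cutoff, equal to `1` on the ball of radius `1/2` and supported in the unit
ball. -/
def cutoff (n : ℕ) : ContDiffBump (0 : EuclideanSpace ℝ (Fin n)) :=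
  ⟨1 / 2, 1, by norm_num, by norm_num⟩

/-- The cutoff centered at `c` at scale `R`. -/
def scaledCutoff (n : ℕ) (c : EuclideanSpace ℝ (Fin n)) (R : ℝ)
    (z : EuclideanSpace ℝ (Fin n)) : ℝ :=
  cutoff n (R⁻¹ • (z - c))

lemma contDiff_scaledCutoff (n : ℕ) (c : EuclideanSpace ℝ (Fin n)) (R : ℝ) :
    ContDiff ℝ (⊤ : ℕ∞) (scaledCutoff n c R) :=
  (cutoff n).contDiff.comp (by fun_prop : ContDiff ℝ (⊤ : ℕ∞) fun z => R⁻¹ • (z - c))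

lemma scaledCutoff_self (n : ℕ) (c : EuclideanSpace ℝ (Fin n)) (R : ℝ) :
    scaledCutoff n c R c = 1 := by
  unfold scaledCutoff
  apply (cutoff n).one_of_mem_closedBall
  simp [(cutoff n).rIn_pos.le]

lemma scaledCutoff_eq_zero {n : ℕ} {c z : EuclideanSpace ℝ (Fin n)} {R : ℝ} (hR : 0 < R)
    (h : R ≤ ‖z - c‖) : scaledCutoff n c R z = 0 := by
  unfold scaledCutoff
  apply (cutoff n).zero_of_le_dist
  rw [dist_zero_right, norm_smul, norm_inv, Real.norm_of_nonneg hR.le]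
  change 1 ≤ _
  rw [inv_mul_eq_div, one_le_div hR]
  exact h

lemma fderiv_scaledCutoff_eq_zero {n : ℕ} {c z : EuclideanSpace ℝ (Fin n)} {R : ℝ} (hR : 0 < R)
    (h : ‖z - c‖ < R / 2 ∨ R < ‖z - c‖) : fderiv ℝ (scaledCutoff n c R) z = 0 := by
  have hcont : Continuous fun w : EuclideanSpace ℝ (Fin n) => ‖w - c‖ := by fun_prop
  rcases h with h | h
  · have : scaledCutoff n c R =ᶠ[nhds z] fun _ => 1 := by
      filter_upwards [hcont.continuousAt.eventually_lt continuousAt_const h] with w hw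
      apply (cutoff n).one_of_mem_closedBall
      rw [mem_closedBall_zero_iff, norm_smul, norm_inv, Real.norm_of_nonneg hR.le]
      change _ ≤ (1 / 2 : ℝ)
      rw [inv_mul_le_iff₀ hR]
      linarith
    rw [this.fderiv_eq]
    simp
  · have : scaledCutoff n c R =ᶠ[nhds z] fun _ => 0 := by
      filter_upwards [continuousAt_const.eventually_lt hcont.continuousAt h] with w hw
      exact scaledCutoff_eq_zero hR hw.le
    rw [this.fderiv_eq]
    simp

lemma exists_norm_fderiv_scaledCutoff_le (n : ℕ) :
    ∃ A : ℝ, 0 < A ∧ ∀ (c : EuclideanSpace ℝ (Fin n)) (R : ℝ), 0 < R → ∀ z,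
      ‖fderiv ℝ (scaledCutoff n c R) z‖ ≤ A / R := by
  have hφ : ContDiff ℝ (⊤ : ℕ∞) (cutoff n) := (cutoff n).contDiff
  obtain ⟨A, hA⟩ := ((cutoff n).hasCompactSupport.fderiv (𝕜 := ℝ)).exists_bound_of_continuous
    (hφ.continuous_fderiv (by simp))
  refine ⟨max A 1, by positivity, fun c R hR z => ?_⟩
  have hz : HasFDerivAt (fun w : EuclideanSpace ℝ (Fin n) => R⁻¹ • (w - c))
      (R⁻¹ • ContinuousLinearMap.id ℝ (EuclideanSpace ℝ (Fin n))) z :=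
    ((hasFDerivAt_id z).sub_const c).const_smul R⁻¹
  have hd := (((hφ.differentiable (by simp)) (R⁻¹ • (z - c))).hasFDerivAt.comp z hz).fderiv
  change ‖fderiv ℝ (cutoff n ∘ fun w => R⁻¹ • (w - c)) z‖ ≤ _
  rw [hd, ContinuousLinearMap.comp_smul, ContinuousLinearMap.comp_id, norm_smul, norm_inv,
    Real.norm_of_nonneg hR.le, inv_mul_eq_div]
  gcongr
  exact (hA _).trans (le_max_left _ _)

lemma abs_lastCoord_sub_le (n : ℕ) (x y : EuclideanSpace ℝ (Fin n)) :
    |lastCoord n x - lastCoord n y| ≤ ‖x - y‖ := by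
  unfold lastCoord
  split_ifs with h
  · exact PiLp.norm_apply_le (x - y) ⟨n - 1, Nat.sub_lt h one_pos⟩
  · simp

lemma measurable_lastCoord (n : ℕ) : Measurable (lastCoord n) := by
  unfold lastCoord
  split_ifs with h
  · fun_prop
  · fun_prop

lemma measurableSet_upperHalf (n : ℕ) : MeasurableSet (upperHalf n) :=
  measurableSet_lt measurable_const (measurable_lastCoord n)

/-- The weight `zₙ^γ` is integrable up to the boundary when `γ > -1`. -/
lemma lintegral_closedBall_weight_le {n : ℕ} (hn : 1 ≤ n) {γ : ℝ} (hγ : -1 < γ)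
    (c : EuclideanSpace ℝ (Fin n)) {R : ℝ} (hR : 0 < R) (hc : lastCoord n c ≤ R) :
    ∫⁻ z in upperHalf n ∩ Metric.closedBall c R, ENNReal.ofReal (lastCoord n z ^ γ) ≤
      ENNReal.ofReal ((2 * R) ^ (n + γ) / (γ + 1)) := by
  set i₀ : Fin n := ⟨n - 1, Nat.sub_lt hn one_pos⟩
  have hlast : ∀ z, lastCoord n z = z i₀ := fun z => by
    unfold lastCoord
    rw [dif_pos (show 0 < n from hn)]
  set f : Fin n → ℝ → ℝ := fun i =>
    if i = i₀ then (Ioc 0 (2 * R)).indicator (fun t => t ^ γ)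
    else (Icc (c i - R) (c i + R)).indicator (fun _ => 1) with hf
  have hf₀ : f i₀ = (Ioc 0 (2 * R)).indicator (fun t => t ^ γ) := by simp [hf]
  have hf₁ : ∀ i, i ≠ i₀ → f i = (Icc (c i - R) (c i + R)).indicator (fun _ => 1) :=
    fun i hi => by simp [hf, hi]
  have hR2 : (0 : ℝ) ≤ 2 * R := by positivity
  have hf_int : ∀ i, Integrable (f i) := fun i => by
    by_cases hi : i = i₀
    · rw [hi, hf₀, integrable_indicator_iff measurableSet_Ioc]
      exact (intervalIntegrable_iff_integrableOn_Ioc_of_le hR2).1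
        (intervalIntegral.intervalIntegrable_rpow' hγ)
    · rw [hf₁ i hi, integrable_indicator_iff measurableSet_Icc]
      exact integrableOn_const (by simp)
  have hnonneg : ∀ i t, 0 ≤ f i t := fun i t => by
    by_cases hi : i = i₀
    · rw [hi, hf₀]
      exact indicator_nonneg (fun s hs => Real.rpow_nonneg hs.1.le _) _
    · rw [hf₁ i hi]
      exact indicator_nonneg (fun s hs => zero_le_one) _
  have hval₀ : ∫ t, f i₀ t = (2 * R) ^ (γ + 1) / (γ + 1) := by
    rw [hf₀, integral_indicator measurableSet_Ioc, ← intervalIntegral.integral_of_le hR2,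
      integral_rpow (Or.inl hγ), Real.zero_rpow (by linarith), sub_zero]
  have hval₁ : ∀ i, i ≠ i₀ → ∫ t, f i t = 2 * R := fun i hi => by
    rw [hf₁ i hi, integral_indicator measurableSet_Icc]
    simp only [integral_const, smul_eq_mul, mul_one, measureReal_restrict_apply_univ,
      Real.volume_real_Icc]
    rw [max_eq_left (by linarith)]
    ring
  have hprod : ∏ i, ∫ t, f i t = (2 * R) ^ (n + γ) / (γ + 1) := by
    rw [← Finset.mul_prod_erase _ _ (Finset.mem_univ i₀), hval₀,
      Finset.prod_congr rfl fun i hi => hval₁ i (Finset.ne_of_mem_erase hi), Finset.prod_const,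
      Finset.card_erase_of_mem (Finset.mem_univ _), Finset.card_univ, Fintype.card_fin,
      ← Real.rpow_natCast, Nat.cast_sub hn, div_mul_eq_mul_div,
      ← Real.rpow_add (by positivity)]
    congr 2
    push_cast
    ring
  have hF : Integrable (fun z : Fin n → ℝ => ∏ i, f i (z i)) := Integrable.fintype_prod hf_int
  rw [← lintegral_indicator ((measurableSet_upperHalf n).inter measurableSet_closedBall)]
  calc ∫⁻ z, (upperHalf n ∩ Metric.closedBall c R).indicator
          (fun z => ENNReal.ofReal (lastCoord n z ^ γ)) z
      ≤ ∫⁻ z : EuclideanSpace ℝ (Fin n), ENNReal.ofReal (∏ i, f i (z i)) := by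
        refine lintegral_mono fun z => ?_
        refine indicator_le (s := upperHalf n ∩ Metric.closedBall c R)
          (g := fun z => ENNReal.ofReal (∏ i, f i (z i))) (fun z hz => ?_) z
        have hzc : ‖z - c‖ ≤ R := by simpa [dist_eq_norm] using hz.2
        have hz0 : 0 < z i₀ := by rw [← hlast]; exact hz.1
        have hcoord : ∀ i, |z i - c i| ≤ R := fun i => (PiLp.norm_apply_le (z - c) i).trans hzc
        refine ENNReal.ofReal_le_ofReal ?_
        rw [← Finset.mul_prod_erase _ _ (Finset.mem_univ i₀), hf₀, Finset.prod_eq_one, mul_one,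
          hlast, indicator_of_mem]
        · have := abs_le.1 (hcoord i₀)
          rw [hlast] at hc
          exact ⟨hz0, by linarith⟩
        · intro i hi
          rw [hf₁ i (Finset.ne_of_mem_erase hi), indicator_of_mem]
          have := abs_le.1 (hcoord i)
          constructor <;> linarith
    _ = ∫⁻ z : Fin n → ℝ, ENNReal.ofReal (∏ i, f i (z i)) :=
        (EuclideanSpace.volume_preserving_symm_measurableEquiv_toLp (Fin n)).lintegral_comp_emb
          (MeasurableEquiv.measurableEmbedding _) (fun z => ENNReal.ofReal (∏ i, f i (z i)))
    _ = ENNReal.ofReal ((2 * R) ^ (n + γ) / (γ + 1)) := by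
        rw [← ofReal_integral_eq_lintegral_ofReal hF
          (Filter.Eventually.of_forall fun z => Finset.prod_nonneg fun i _ => hnonneg i _),
          ← hprod, integral_fintype_prod_volume_eq_prod]

lemma energy_scaledCutoff_le {n : ℕ} {γ p A : ℝ} (hp : 0 < p) (hA : 0 < A)
    {c : EuclideanSpace ℝ (Fin n)} {R : ℝ} (hR : 0 < R)
    (hbound : ∀ z, ‖fderiv ℝ (scaledCutoff n c R) z‖ ≤ A / R) :
    energy n γ p (scaledCutoff n c R) ≤ ENNReal.ofReal ((A / R) ^ p) *
      ∫⁻ z in upperHalf n ∩ Metric.closedBall c R, ENNReal.ofReal (lastCoord n z ^ γ) := by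
  unfold energy
  rw [← lintegral_const_mul' _ _ ENNReal.ofReal_ne_top, inter_comm,
    ← Measure.restrict_restrict measurableSet_closedBall,
    ← lintegral_indicator measurableSet_closedBall]
  refine setLIntegral_mono' (measurableSet_upperHalf n) fun z hz => ?_
  by_cases hzR : z ∈ Metric.closedBall c R
  · rw [indicator_of_mem hzR, ← ENNReal.ofReal_mul (by positivity)]
    refine ENNReal.ofReal_le_ofReal ?_
    have : 0 < lastCoord n z := hz
    gcongr
    exact hbound z
  · rw [Metric.mem_closedBall, not_le, dist_eq_norm] at hzR
    rw [fderiv_scaledCutoff_eq_zero hR (Or.inr hzR), norm_zero, Real.zero_rpow hp.ne', zero_mul,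
      ENNReal.ofReal_zero]
    exact zero_le

lemma exists_energy_scaledCutoff_interior_le (n : ℕ) (γ : ℝ) {p : ℝ} (hp : 0 < p) :
    ∃ K : ℝ, 0 < K ∧ ∀ c ∈ upperHalf n, ∀ R : ℝ, 0 < R → R ≤ lastCoord n c / 2 →
      energy n γ p (scaledCutoff n c R) ≤
        ENNReal.ofReal (K * (R ^ (n - p) * lastCoord n c ^ γ)) := by
  obtain ⟨A, hA, hbound⟩ := exists_norm_fderiv_scaledCutoff_le n
  set v : ℝ := (volume (Metric.ball (0 : EuclideanSpace ℝ (Fin n)) 1)).toReal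
  have hvol : volume (Metric.ball (0 : EuclideanSpace ℝ (Fin n)) 1) = ENNReal.ofReal v :=
    (ENNReal.ofReal_toReal measure_ball_lt_top.ne).symm
  have hvpos : 0 < v :=
    ENNReal.toReal_pos (Metric.measure_ball_pos volume _ one_pos).ne' measure_ball_lt_top.ne
  refine ⟨A ^ p * 2 ^ |γ| * v, by positivity, fun c hc R hR hRc => ?_⟩
  have hc0 : 0 < lastCoord n c := hc
  refine (energy_scaledCutoff_le hp hA hR (hbound c R hR)).trans ?_
  have hweight : ∫⁻ z in upperHalf n ∩ Metric.closedBall c R,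
      ENNReal.ofReal (lastCoord n z ^ γ) ≤
        ENNReal.ofReal (2 ^ |γ| * lastCoord n c ^ γ * (R ^ n * v)) := by
    calc ∫⁻ z in upperHalf n ∩ Metric.closedBall c R, ENNReal.ofReal (lastCoord n z ^ γ)
        ≤ ∫⁻ z in upperHalf n ∩ Metric.closedBall c R,
            ENNReal.ofReal (2 ^ |γ| * lastCoord n c ^ γ) := by
          refine setLIntegral_mono'
            ((measurableSet_upperHalf n).inter measurableSet_closedBall) fun z hz => ?_
          refine ENNReal.ofReal_le_ofReal ?_
          have hz0 : 0 < lastCoord n z := hz.1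
          have hzc : ‖z - c‖ ≤ R := by simpa [dist_eq_norm] using hz.2
          have hd := abs_le.1 ((abs_lastCoord_sub_le n z c).trans hzc)
          rcases le_total 0 γ with hγ | hγ
          · rw [abs_of_nonneg hγ, ← Real.mul_rpow (by norm_num) hc0.le]
            exact Real.rpow_le_rpow hz0.le (by linarith) hγ
          · have h2 : (2 : ℝ) ^ |γ| = (1 / 2) ^ γ := by
              rw [abs_of_nonpos hγ, Real.rpow_neg (by norm_num), one_div,
                Real.inv_rpow (by norm_num)]
            rw [h2, ← Real.mul_rpow (by norm_num) hc0.le]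
            exact Real.rpow_le_rpow_of_nonpos (by positivity) (by linarith) hγ
      _ ≤ ENNReal.ofReal (2 ^ |γ| * lastCoord n c ^ γ) * volume (Metric.closedBall c R) := by
          rw [setLIntegral_const]
          gcongr
          exact inter_subset_right
      _ = ENNReal.ofReal (2 ^ |γ| * lastCoord n c ^ γ * (R ^ n * v)) := by
          rw [Measure.addHaar_closedBall _ _ hR.le, finrank_euclideanSpace_fin, hvol,
            ← ENNReal.ofReal_mul (by positivity), ← ENNReal.ofReal_mul (by positivity)]
  refine (mul_le_mul_right hweight _).trans ?_
  rw [← ENNReal.ofReal_mul (by positivity)]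
  refine ENNReal.ofReal_le_ofReal (le_of_eq ?_)
  rw [Real.div_rpow hA.le hR.le, Real.rpow_sub hR, Real.rpow_natCast]
  field_simp

lemma exists_energy_scaledCutoff_boundary_le {n : ℕ} (hn : 1 ≤ n) {γ p : ℝ} (hp : 0 < p)
    (hγ : -1 < γ) :
    ∃ K : ℝ, 0 < K ∧ ∀ (c : EuclideanSpace ℝ (Fin n)) (R : ℝ), 0 < R → lastCoord n c ≤ R →
      energy n γ p (scaledCutoff n c R) ≤ ENNReal.ofReal (K * R ^ (n + γ - p)) := by
  obtain ⟨A, hA, hbound⟩ := exists_norm_fderiv_scaledCutoff_le n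
  have hγ' : 0 < γ + 1 := by linarith
  refine ⟨A ^ p * 2 ^ (n + γ) / (γ + 1), by positivity, fun c R hR hRc => ?_⟩
  refine (energy_scaledCutoff_le hp hA hR (hbound c R hR)).trans ?_
  refine (mul_le_mul_right (lintegral_closedBall_weight_le hn hγ c hR hRc) _).trans ?_
  rw [← ENNReal.ofReal_mul (by positivity)]
  refine ENNReal.ofReal_le_ofReal (le_of_eq ?_)
  rw [Real.div_rpow hA.le hR.le, Real.rpow_sub hR, Real.mul_rpow (by norm_num) hR.le]
  field_simp

/-- Cutoffs at scales `4 ^ k * m` around a common center have gradients with disjoint supports,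
so that their energies add up. -/
lemma energy_sum_scaledCutoff_le {n : ℕ} {γ p : ℝ} (hp : 0 < p)
    (c : EuclideanSpace ℝ (Fin n)) {m : ℝ} (hm : 0 < m) (N : ℕ) :
    energy n γ p (fun z => ∑ k ∈ Finset.range N, scaledCutoff n c (4 ^ k * m) z) ≤
      ∑ k ∈ Finset.range N, energy n γ p (scaledCutoff n c (4 ^ k * m)) := by
  unfold energy
  have hmeas : ∀ k, Measurable fun z => ENNReal.ofReal
      (‖fderiv ℝ (scaledCutoff n c (4 ^ k * m)) z‖ ^ p * lastCoord n z ^ γ) := fun k =>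
    (((measurable_fderiv ℝ _).norm.pow_const p).mul
      ((measurable_lastCoord n).pow_const γ)).ennreal_ofReal
  rw [← lintegral_finsetSum _ fun k _ => hmeas k]
  refine setLIntegral_mono' (measurableSet_upperHalf n) fun z _ => ?_
  rw [fderiv_fun_sum fun k _ => (contDiff_scaledCutoff n c _).differentiable (by simp) z]
  by_cases h : ∃ k ∈ Finset.range N, fderiv ℝ (scaledCutoff n c (4 ^ k * m)) z ≠ 0
  · obtain ⟨k, hk, hkz⟩ := h
    have hannulus : ∀ j, fderiv ℝ (scaledCutoff n c (4 ^ j * m)) z ≠ 0 →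
        4 ^ j * m / 2 ≤ ‖z - c‖ ∧ ‖z - c‖ ≤ 4 ^ j * m := fun j hj => by
      by_contra hcon
      refine hj (fderiv_scaledCutoff_eq_zero (by positivity) ?_)
      rw [not_and_or, not_le, not_le] at hcon
      exact hcon
    have hlt : ∀ i j, fderiv ℝ (scaledCutoff n c (4 ^ i * m)) z ≠ 0 →
        fderiv ℝ (scaledCutoff n c (4 ^ j * m)) z ≠ 0 → ¬ i < j := fun i j hi hj hij => by
      have h1 := (hannulus i hi).2
      have h2 := (hannulus j hj).1
      have h3 : (4 : ℝ) ^ (i + 1) ≤ 4 ^ j := pow_le_pow_right₀ (by norm_num) hij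
      have h4 : (4 : ℝ) ^ (i + 1) * m ≤ 4 ^ j * m := by gcongr
      have h5 : (0 : ℝ) < 4 ^ i * m := by positivity
      rw [pow_succ] at h4
      linarith
    rw [Finset.sum_eq_single_of_mem k hk fun j _ hjk => by
      by_contra hj
      rcases lt_or_gt_of_ne hjk with h | h
      · exact hlt _ _ hj hkz h
      · exact hlt _ _ hkz hj h]
    exact Finset.single_le_sum (f := fun k => ENNReal.ofReal
      (‖fderiv ℝ (scaledCutoff n c (4 ^ k * m)) z‖ ^ p * lastCoord n z ^ γ))
      (fun _ _ => zero_le) hk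
  · push Not at h
    rw [Finset.sum_eq_zero h, norm_zero, Real.zero_rpow hp.ne', zero_mul, ENNReal.ofReal_zero]
    exact zero_le

/-- `w` is an admissible constant in the weighted Morrey estimate at the pair `x, y`. -/
def IsMorreyBound (n : ℕ) (γ p : ℝ) (x y : EuclideanSpace ℝ (Fin n)) (w : ℝ) : Prop :=
  0 ≤ w ∧ ∀ u : EuclideanSpace ℝ (Fin n) → ℝ, ContDiff ℝ (⊤ : ℕ∞) u → energy n γ p u < ⊤ →
    |u x - u y| ≤ w * (energy n γ p u).toReal ^ (1 / p)

lemma IsMorreyBound.symm {n : ℕ} {γ p : ℝ} {x y : EuclideanSpace ℝ (Fin n)} {w : ℝ}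
    (h : IsMorreyBound n γ p x y w) : IsMorreyBound n γ p y x w :=
  ⟨h.1, fun u hu hE => abs_sub_comm (u x) (u y) ▸ h.2 u hu hE⟩

lemma IsMorreyBound.abs_sub_le {n : ℕ} {γ p : ℝ} {x y : EuclideanSpace ℝ (Fin n)} {w : ℝ}
    (h : IsMorreyBound n γ p x y w) (hp : 0 < p) {u : EuclideanSpace ℝ (Fin n) → ℝ}
    (hu : ContDiff ℝ (⊤ : ℕ∞) u) {B : ℝ} (hB : 0 ≤ B)
    (hE : energy n γ p u ≤ ENNReal.ofReal B) : |u x - u y| ≤ w * B ^ (1 / p) := by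
  refine (h.2 u hu (hE.trans_lt ENNReal.ofReal_lt_top)).trans ?_
  have := h.1
  gcongr
  exact ENNReal.toReal_le_of_le_ofReal hB hE

lemma IsMorreyBound.exists_interior_le (n : ℕ) (γ : ℝ) {p : ℝ} (hp : 0 < p) :
    ∃ K : ℝ, 0 < K ∧ ∀ x ∈ upperHalf n, ∀ y w, x ≠ y → IsMorreyBound n γ p x y w →
      min ‖x - y‖ (lastCoord n x) ^ (1 - n / p) * lastCoord n x ^ (-(γ / p)) ≤ K * w := by
  obtain ⟨K, hK, hE⟩ := exists_energy_scaledCutoff_interior_le n γ hp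
  refine ⟨2 ^ (1 - n / p) * K ^ (1 / p), by positivity, fun x hx y w hxy hw => ?_⟩
  have hx0 : 0 < lastCoord n x := hx
  have hr : 0 < ‖x - y‖ := norm_pos_iff.2 (sub_ne_zero.2 hxy)
  set s := min ‖x - y‖ (lastCoord n x)
  have hs0 : 0 < s := lt_min hr hx0
  have hsr : s ≤ ‖x - y‖ := min_le_left _ _
  have hsx : s ≤ lastCoord n x := min_le_right _ _
  have key := hw.abs_sub_le hp (contDiff_scaledCutoff n x (s / 2)) (by positivity)
    (hE x hx (s / 2) (by positivity) (by linarith))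
  rw [scaledCutoff_self, scaledCutoff_eq_zero (by positivity)
    (by rw [norm_sub_rev]; linarith), sub_zero, abs_one,
    Real.mul_rpow hK.le (by positivity), Real.mul_rpow (by positivity) (by positivity),
    ← Real.rpow_mul (by positivity), ← Real.rpow_mul hx0.le, Real.div_rpow hs0.le (by norm_num)]
    at key
  have e1 : ((n : ℝ) - p) * (1 / p) = -(1 - n / p) := by field_simp; ring
  have e2 : γ * (1 / p) = γ / p := by ring
  rw [e1, e2, Real.rpow_neg hs0.le, Real.rpow_neg (by norm_num : (0 : ℝ) ≤ 2)] at key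
  rw [Real.rpow_neg hx0.le]
  have hs1 : 0 < s ^ (1 - n / p) := by positivity
  have hx1 : 0 < lastCoord n x ^ (γ / p) := by positivity
  calc s ^ (1 - n / p) * (lastCoord n x ^ (γ / p))⁻¹
      = s ^ (1 - n / p) * (lastCoord n x ^ (γ / p))⁻¹ * 1 := (mul_one _).symm
    _ ≤ s ^ (1 - n / p) * (lastCoord n x ^ (γ / p))⁻¹ * _ :=
        mul_le_mul_of_nonneg_left key (by positivity)
    _ = 2 ^ (1 - n / p) * K ^ (1 / p) * w := by field_simp

lemma IsMorreyBound.exists_boundary_le {n : ℕ} (hn : 1 ≤ n) {γ p : ℝ} (hp : 0 < p)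
    (hγ : -1 < γ) :
    ∃ K : ℝ, 0 < K ∧ ∀ x y w, x ≠ y → lastCoord n x ≤ ‖x - y‖ → IsMorreyBound n γ p x y w →
      ‖x - y‖ ^ (1 - (n + γ) / p) ≤ K * w := by
  obtain ⟨K, hK, hE⟩ := exists_energy_scaledCutoff_boundary_le hn hp hγ
  refine ⟨K ^ (1 / p), by positivity, fun x y w hxy hx hw => ?_⟩
  have hr : 0 < ‖x - y‖ := norm_pos_iff.2 (sub_ne_zero.2 hxy)
  have key := hw.abs_sub_le hp (contDiff_scaledCutoff n x ‖x - y‖) (by positivity)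
    (hE x _ hr hx)
  have e1 : ((n : ℝ) + γ - p) * (1 / p) = -(1 - (n + γ) / p) := by field_simp; ring
  rw [scaledCutoff_self, scaledCutoff_eq_zero hr (by rw [norm_sub_rev]), sub_zero, abs_one,
    Real.mul_rpow hK.le (by positivity), ← Real.rpow_mul hr.le, e1, Real.rpow_neg hr.le,
    ← mul_assoc, ← div_eq_mul_inv, one_le_div (by positivity)] at key
  linarith

lemma IsMorreyBound.exists_critical_le {n : ℕ} (hn : 1 ≤ n) {p : ℝ} (hp : (n : ℝ) < p) :
    ∃ K : ℝ, 0 < K ∧ ∀ x ∈ upperHalf n, ∀ y w, ∀ N : ℕ, 0 < N →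
      4 ^ (N - 1) * lastCoord n x ≤ ‖x - y‖ → IsMorreyBound n (p - n) p x y w →
      (N : ℝ) ^ (1 - 1 / p) ≤ K * w := by
  have hp0 : 0 < p := (Nat.cast_nonneg n).trans_lt hp
  obtain ⟨K, hK, hE⟩ := exists_energy_scaledCutoff_boundary_le (γ := p - n) hn hp0
    (by linarith)
  refine ⟨K ^ (1 / p), by positivity, fun x hx y w N hN hxy hw => ?_⟩
  have hx0 : 0 < lastCoord n x := hx
  have hN0 : (0 : ℝ) < N := by exact_mod_cast hN
  have henergy := (energy_sum_scaledCutoff_le (γ := p - n) hp0 x hx0 N).trans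
    (Finset.sum_le_sum (g := fun _ => ENNReal.ofReal K) fun k _ => by
      have h4 : (1 : ℝ) ≤ 4 ^ k := one_le_pow₀ (by norm_num)
      simpa using hE x (4 ^ k * lastCoord n x) (by positivity)
        (le_mul_of_one_le_left hx0.le h4))
  rw [Finset.sum_const, Finset.card_range, nsmul_eq_mul, ← ENNReal.ofReal_natCast,
    ← ENNReal.ofReal_mul hN0.le] at henergy
  have key := hw.abs_sub_le hp0 (ContDiff.sum fun k _ => contDiff_scaledCutoff n x _)
    (by positivity) henergy
  have hy : ∑ k ∈ Finset.range N, scaledCutoff n x (4 ^ k * lastCoord n x) y = 0 :=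
    Finset.sum_eq_zero fun k hk => by
      refine scaledCutoff_eq_zero (by positivity) (le_trans ?_ (hxy.trans (norm_sub_rev x y).le))
      have : k ≤ N - 1 := Nat.le_sub_one_of_lt (Finset.mem_range.1 hk)
      gcongr
      norm_num
  have hxx : ∑ k ∈ Finset.range N, scaledCutoff n x (4 ^ k * lastCoord n x) x = N := by
    simp [scaledCutoff_self]
  rw [hy, hxx, sub_zero, abs_of_pos hN0, Real.mul_rpow hN0.le hK.le] at key
  rw [Real.rpow_sub hN0, Real.rpow_one, div_le_iff₀ (by positivity)]
  linarith

lemma Theta_comm (n : ℕ) (γ p : ℝ) (x y : EuclideanSpace ℝ (Fin n)) :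
    Theta n γ p x y = Theta n γ p y x := by
  unfold Theta
  rw [norm_sub_rev, min_comm, max_comm (lastCoord n x)]

lemma Theta_self {n : ℕ} (hn : 1 ≤ n) (γ : ℝ) {p : ℝ} (hp : (n : ℝ) < p)
    (x : EuclideanSpace ℝ (Fin n)) : Theta n γ p x x = 0 := by
  have hn' : (1 : ℝ) ≤ n := by exact_mod_cast hn
  have hp0 : 0 < p := by linarith
  have h1 : 1 - (n : ℝ) / p ≠ 0 := (sub_pos.2 ((div_lt_one hp0).2 hp)).ne'
  have h2 : (p - n) / (p - 1) ≠ 0 := (div_pos (by linarith) (by linarith)).ne'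
  have h3 : 1 - 1 / p ≠ 0 := (sub_pos.2 ((div_lt_one hp0).2 (by linarith))).ne'
  unfold Theta
  simp only [sub_self, norm_zero, zero_div, Real.zero_rpow h1, Real.zero_rpow h2, add_zero,
    Real.log_one, Real.zero_rpow h3, mul_zero, ite_self]

lemma mul_div_max_rpow_le {m r a : ℝ} (hm : 0 < m) (hr : 0 < r) (ha : 0 ≤ a) {D : ℝ}
    (hmD : m ≤ D) (hrD : r ≤ D) : m ^ a * r ^ a / D ^ a ≤ min r m ^ a := by
  have hD : 0 < D := hm.trans_le hmD
  rw [← Real.mul_rpow hm.le hr.le, ← Real.div_rpow (by positivity) hD.le]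
  refine Real.rpow_le_rpow (by positivity) (le_min ?_ ?_) ha
  · rw [div_le_iff₀ hD, mul_comm]
    gcongr
  · rw [div_le_iff₀ hD]
    gcongr

lemma IsMorreyBound.exists_Theta_le_supercritical {n : ℕ} {γ p : ℝ}
    (hp : 0 < p) (hnp : (n : ℝ) < p) (hγ : p - n < γ) :
    ∃ K : ℝ, 0 < K ∧ ∀ x ∈ upperHalf n, ∀ y w, lastCoord n x ≤ lastCoord n y → x ≠ y →
      IsMorreyBound n γ p x y w → Theta n γ p x y ≤ K * w := by
  obtain ⟨K, hK, h⟩ := IsMorreyBound.exists_interior_le n γ hp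
  refine ⟨K, hK, fun x hx y w hle hxy hw => le_trans ?_ (h x hx y w hxy hw)⟩
  have hx0 : 0 < lastCoord n x := hx
  have hr : 0 < ‖x - y‖ := norm_pos_iff.2 (sub_ne_zero.2 hxy)
  have ha : 0 ≤ 1 - (n : ℝ) / p := (sub_pos.2 ((div_lt_one hp).2 hnp)).le
  unfold Theta
  rw [if_pos hγ, min_eq_left hle, max_eq_right hle]
  have e : ((n : ℝ) + γ) / p - 1 = -(1 - n / p + -(γ / p)) := by ring
  rw [e, Real.rpow_neg hx0.le, Real.rpow_add hx0]
  refine le_trans (le_of_eq ?_) (mul_le_mul_of_nonneg_right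
    (mul_div_max_rpow_le hx0 hr ha (hle.trans (le_max_left _ ‖x - y‖))
      (le_max_right (lastCoord n y) ‖x - y‖)) (by positivity))
  have : 0 < max (lastCoord n y) ‖x - y‖ := lt_max_of_lt_right hr
  field_simp

lemma IsMorreyBound.exists_Theta_le_critical {n : ℕ} (hn : 1 ≤ n) {p : ℝ}
    (hnp : (n : ℝ) < p) :
    ∃ K : ℝ, 0 < K ∧ ∀ x ∈ upperHalf n, ∀ y w, lastCoord n x ≤ lastCoord n y → x ≠ y →
      IsMorreyBound n (p - n) p x y w → Theta n (p - n) p x y ≤ K * w := by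
  have hn' : (1 : ℝ) ≤ n := by exact_mod_cast hn
  have hp : 0 < p := by linarith
  have hp1 : 0 < p - 1 := by linarith
  obtain ⟨K₁, hK₁, h₁⟩ := IsMorreyBound.exists_interior_le n (p - n) hp
  obtain ⟨K₂, hK₂, h₂⟩ := IsMorreyBound.exists_critical_le hn hnp
  have hlog4 : 0 < Real.log 4 := Real.log_pos (by norm_num)
  refine ⟨max K₁ ((2 * Real.log 4) ^ (1 - 1 / p) * K₂), by positivity,
    fun x hx y w hle hxy hw => ?_⟩
  have hx0 : 0 < lastCoord n x := hx
  have hr : 0 < ‖x - y‖ := norm_pos_iff.2 (sub_ne_zero.2 hxy)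
  have hw0 := hw.1
  have hq : 0 ≤ 1 - 1 / p := (sub_pos.2 ((div_lt_one hp).2 (by linarith))).le
  have ha : 0 < (p - n) / (p - 1) := div_pos (by linarith) hp1
  unfold Theta
  rw [if_neg (lt_irrefl _), if_pos rfl, min_eq_left hle]
  have ht : 0 < ‖x - y‖ / lastCoord n x := by positivity
  have hlog0 : 0 ≤ Real.log (1 + (‖x - y‖ / lastCoord n x) ^ ((p - n) / (p - 1))) :=
    Real.log_nonneg (le_add_of_nonneg_right (by positivity))
  rcases le_total ‖x - y‖ (lastCoord n x) with hsmall | hlarge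
  · refine le_trans ?_ (mul_le_mul_of_nonneg_right (le_max_left _ _) hw0)
    refine le_trans ?_ (h₁ x hx y w hxy hw)
    have hlog : Real.log (1 + (‖x - y‖ / lastCoord n x) ^ ((p - n) / (p - 1))) ≤
        (‖x - y‖ / lastCoord n x) ^ ((p - n) / (p - 1)) :=
      (Real.log_le_sub_one_of_pos (by positivity)).trans (by linarith)
    refine (Real.rpow_le_rpow hlog0 hlog hq).trans (le_of_eq ?_)
    have e1 : (p - n) / (p - 1) * (1 - 1 / p) = 1 - n / p := by field_simp
    have e2 : (p - n) / p = 1 - n / p := by field_simp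
    rw [min_eq_left hsmall, ← Real.rpow_mul ht.le, e1, e2, Real.div_rpow hr.le hx0.le,
      Real.rpow_neg hx0.le, div_eq_mul_inv]
  · refine le_trans ?_ (mul_le_mul_of_nonneg_right (le_max_right _ _) hw0)
    have ht1 : 1 ≤ ‖x - y‖ / lastCoord n x := (one_le_div hx0).2 hlarge
    obtain ⟨k, hk, hk'⟩ := exists_nat_pow_near ht1 (by norm_num : (1 : ℝ) < 4)
    have key := h₂ x hx y w (k + 1) k.succ_pos (by simpa using (le_div_iff₀ hx0).1 hk) hw
    rw [mul_assoc]
    refine le_trans ?_ (mul_le_mul_of_nonneg_left key (by positivity))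
    rw [← Real.mul_rpow (by positivity) (by positivity)]
    refine Real.rpow_le_rpow hlog0 ?_ hq
    have hpow : (‖x - y‖ / lastCoord n x) ^ ((p - n) / (p - 1)) ≤ ‖x - y‖ / lastCoord n x :=
      (Real.rpow_le_rpow_of_exponent_le ht1 ((div_le_one hp1).2 (by linarith))).trans_eq
        (Real.rpow_one _)
    have h41 : (1 : ℝ) ≤ 4 ^ (k + 1) := one_le_pow₀ (by norm_num)
    calc Real.log (1 + (‖x - y‖ / lastCoord n x) ^ ((p - n) / (p - 1)))
        ≤ Real.log (4 * 4 ^ (k + 1)) := Real.log_le_log (by positivity) (by linarith)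
      _ = (k + 2) * Real.log 4 := by
          rw [← pow_succ', Real.log_pow]
          push_cast
          ring
      _ ≤ 2 * Real.log 4 * (k + 1 : ℕ) := by
          push_cast
          nlinarith [mul_nonneg (Nat.cast_nonneg (α := ℝ) k) hlog4.le]

lemma IsMorreyBound.exists_Theta_le_subcritical {n : ℕ} (hn : 1 ≤ n) {γ p : ℝ}
    (hp : 0 < p) (hγ : γ < p - n) (hγ' : -1 < γ) :
    ∃ K : ℝ, 0 < K ∧ ∀ x ∈ upperHalf n, ∀ y ∈ upperHalf n, ∀ w,
      lastCoord n x ≤ lastCoord n y → x ≠ y →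
      IsMorreyBound n γ p x y w → Theta n γ p x y ≤ K * w := by
  obtain ⟨K₁, hK₁, h₁⟩ := IsMorreyBound.exists_interior_le n γ hp
  obtain ⟨K₂, hK₂, h₂⟩ := IsMorreyBound.exists_boundary_le hn hp hγ'
  refine ⟨max K₁ K₂, by positivity, fun x hx y hy w hle hxy hw => ?_⟩
  have hy0 : 0 < lastCoord n y := hy
  have hr : 0 < ‖x - y‖ := norm_pos_iff.2 (sub_ne_zero.2 hxy)
  unfold Theta
  rw [if_neg hγ.not_gt, if_neg hγ.ne, if_pos hγ', max_eq_right hle]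
  rcases le_total ‖x - y‖ (lastCoord n y) with hnear | hfar
  · refine le_trans ?_ (mul_le_mul_of_nonneg_right (le_max_left _ _) hw.1)
    have := h₁ y hy x w hxy.symm hw.symm
    rw [norm_sub_rev, min_eq_left hnear, Real.rpow_neg hy0.le, ← div_eq_mul_inv] at this
    rwa [max_eq_left hnear]
  · refine le_trans ?_ (mul_le_mul_of_nonneg_right (le_max_right _ _) hw.1)
    have := h₂ x y w hxy (hle.trans hfar) hw
    have e : 1 - (n : ℝ) / p - γ / p = 1 - (n + γ) / p := by ring
    rwa [max_eq_right hfar, ← Real.rpow_sub hr, e]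

lemma IsMorreyBound.exists_Theta_le_singular {n : ℕ} {γ p : ℝ}
    (hp : 0 < p) (hnp : (n : ℝ) < p) (hγ : γ ≤ -1) :
    ∃ K : ℝ, 0 < K ∧ ∀ x y : EuclideanSpace ℝ (Fin n), y ∈ upperHalf n → ∀ w,
      lastCoord n x ≤ lastCoord n y → x ≠ y →
      IsMorreyBound n γ p x y w → Theta n γ p x y ≤ K * w := by
  obtain ⟨K, hK, h⟩ := IsMorreyBound.exists_interior_le n γ hp
  refine ⟨K, hK, fun x y hy w hle hxy hw => le_trans ?_ (h y hy x w hxy.symm hw.symm)⟩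
  have hy0 : 0 < lastCoord n y := hy
  have hr : 0 < ‖x - y‖ := norm_pos_iff.2 (sub_ne_zero.2 hxy)
  have ha : 0 ≤ 1 - (n : ℝ) / p := (sub_pos.2 ((div_lt_one hp).2 hnp)).le
  unfold Theta
  rw [if_neg (by linarith), if_neg (by linarith), if_neg hγ.not_gt, max_eq_right hle,
    norm_sub_rev y x]
  have e : 1 - ((n : ℝ) + γ) / p = 1 - n / p + -(γ / p) := by ring
  rw [e, Real.rpow_add hy0]
  refine le_trans (le_of_eq ?_) (mul_le_mul_of_nonneg_right
    (mul_div_max_rpow_le hy0 hr ha (le_max_left _ ‖x - y‖)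
      (le_max_right (lastCoord n y) ‖x - y‖)) (by positivity))
  ring

lemma IsMorreyBound.exists_Theta_le {n : ℕ} (hn : 1 ≤ n) (γ : ℝ) {p : ℝ} (hnp : (n : ℝ) < p) :
    ∃ K : ℝ, 0 < K ∧ ∀ x ∈ upperHalf n, ∀ y ∈ upperHalf n, ∀ w,
      lastCoord n x ≤ lastCoord n y → x ≠ y →
      IsMorreyBound n γ p x y w → Theta n γ p x y ≤ K * w := by
  have hp : 0 < p := (Nat.cast_nonneg n).trans_lt hnp
  rcases lt_trichotomy (p - n) γ with hγ | rfl | hγ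
  · obtain ⟨K, hK, h⟩ := exists_Theta_le_supercritical hp hnp hγ
    exact ⟨K, hK, fun x hx y _ => h x hx y⟩
  · obtain ⟨K, hK, h⟩ := exists_Theta_le_critical hn hnp
    exact ⟨K, hK, fun x hx y _ => h x hx y⟩
  · rcases lt_or_ge (-1) γ with hγ' | hγ'
    · exact exists_Theta_le_subcritical hn hp hγ hγ'
    · obtain ⟨K, hK, h⟩ := exists_Theta_le_singular hp hnp hγ'
      exact ⟨K, hK, fun x _ y hy => h x y hy⟩

/-- Optimality of the weighted Morrey–Sobolev inequality. -/
theorem weighted_morrey_sobolev_optimal (n : ℕ) (hn : 1 ≤ n) (p γ : ℝ) (hnp : (n : ℝ) < p) :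
    ∃ C : ℝ, 0 < C ∧
      ∀ ω : EuclideanSpace ℝ (Fin n) → EuclideanSpace ℝ (Fin n) → ℝ,
        ContinuousOn (fun q : EuclideanSpace ℝ (Fin n) × EuclideanSpace ℝ (Fin n) => ω q.1 q.2)
          (upperHalf n ×ˢ upperHalf n) →
        (∀ x ∈ upperHalf n, ∀ y ∈ upperHalf n, 0 ≤ ω x y) →
        (∀ u : EuclideanSpace ℝ (Fin n) → ℝ, ContDiff ℝ (⊤ : ℕ∞) u → energy n γ p u < ⊤ →
          ∀ x ∈ upperHalf n, ∀ y ∈ upperHalf n,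
            |u x - u y| ≤ ω x y * (energy n γ p u).toReal ^ (1 / p)) →
        ∀ x ∈ upperHalf n, ∀ y ∈ upperHalf n, C * Theta n γ p x y ≤ ω x y := by
  obtain ⟨K, hK, h⟩ := IsMorreyBound.exists_Theta_le hn γ hnp
  refine ⟨K⁻¹, inv_pos.2 hK, fun ω _ hω hest x hx y hy => ?_⟩
  have hw : IsMorreyBound n γ p x y (ω x y) :=
    ⟨hω x hx y hy, fun u hu hE => hest u hu hE x hx y hy⟩
  rw [inv_mul_le_iff₀ hK]
  rcases eq_or_ne x y with rfl | hxy
  · rw [Theta_self hn γ hnp]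
    exact mul_nonneg hK.le hw.1
  rcases le_total (lastCoord n x) (lastCoord n y) with hle | hle
  · exact h x hx y hy _ hle hxy hw
  · rw [Theta_comm]
    exact h y hy x hx _ hle hxy.symm hw.symm
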